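/- If α₁, …, αₘ are pairwise distinct nonzero algebraic complex numbers and c₁, …, cₘ are rational numbers not all zero, then the number c₁·e^{α₁} + ⋯ + cₘ·e^{αₘ} is transcendental. -/

import Mathlib

namespace LindemannWeierstrass

open Polynomial
open scoped Nat

theorem exists_int_polynomial_eval_zero_ne_zero {K : Type*} [Field K] [NumberField K]
    (s : Finset K) (hs : (0 : K) ∉ s) :
    ∃ f : ℤ[X], f.eval 0 ≠ 0 ∧ ∀ a ∈ s, aeval a f = 0 := by
  set q : ℚ[X] := ∏ a ∈ s, minpoly ℚ a with hq
  obtain ⟨b, hb, hbq⟩ := IsLocalization.integerNormalization_spec (nonZeroDivisors ℤ) q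
  have hb0 : b ≠ 0 := nonZeroDivisors.ne_zero hb
  refine ⟨IsLocalization.integerNormalization (nonZeroDivisors ℤ) q, fun h ↦ ?_, fun a ha ↦ ?_⟩
  · have h0 := congrArg (coeff · 0) hbq
    simp only [coeff_map, coeff_smul] at h0
    rw [coeff_zero_eq_eval_zero, h, map_zero, coeff_zero_eq_eval_zero, eq_comm,
      smul_eq_zero, hq, eval_prod, Finset.prod_eq_zero_iff] at h0
    obtain h0 | ⟨a, ha, h0⟩ := h0
    · exact hb0 h0
    · rw [← coeff_zero_eq_eval_zero] at h0
      exact minpoly.coeff_zero_ne_zero (Algebra.IsIntegral.isIntegral a)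
        (ne_of_mem_of_not_mem ha hs) h0
  · apply IsLocalization.integerNormalization_aeval_eq_zero
    rw [hq, map_prod]
    exact Finset.prod_eq_zero ha (minpoly.aeval ℚ a)

theorem isIntegral_pow_mul_aeval {R A : Type*} [CommRing R] [CommRing A] [Algebra R A] {r : R}
    {a : A} (ha : IsIntegral R (r • a)) (g : R[X]) {D : ℕ} (hg : g.natDegree ≤ D) :
    IsIntegral R (r ^ D • aeval a g) := by
  rw [aeval_eq_sum_range' (Nat.lt_succ_of_le hg), Finset.smul_sum]
  refine IsIntegral.sum _ fun i hi ↦ ?_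
  have hi : i ≤ D := Nat.lt_succ_iff.mp (Finset.mem_range.mp hi)
  have : r ^ D • g.coeff i • a ^ i = (r ^ (D - i) * g.coeff i) • (r • a) ^ i := by
    rw [_root_.smul_pow, smul_smul, smul_smul, mul_right_comm, ← pow_add, Nat.sub_add_cancel hi]
  rw [this]
  exact (ha.pow i).smul _

theorem exists_int_eq_of_isIntegral_of_forall_fixed {K : Type*} [Field K] [NumberField K]
    [IsGalois ℚ K] {x : K} (hx : IsIntegral ℤ x) (hfix : ∀ σ : K ≃ₐ[ℚ] K, σ x = x) :
    ∃ n : ℤ, (n : K) = x := by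
  obtain ⟨q, rfl⟩ := (IsGalois.mem_range_algebraMap_iff_fixed x).mpr hfix
  rw [isIntegral_algebraMap_iff (algebraMap ℚ K).injective] at hx
  obtain ⟨n, rfl⟩ := IsIntegrallyClosed.isIntegral_iff.mp hx
  exact ⟨n, by simp⟩

theorem tendsto_mul_pow_div_factorial_pred (C x : ℝ) :
    Filter.Tendsto (fun n : ℕ ↦ C * (x ^ n / (n - 1)!)) Filter.atTop (nhds 0) := by
  rw [← Filter.tendsto_add_atTop_iff_nat 1]
  have := (FloorSemiring.tendsto_pow_div_factorial_atTop x).const_mul (C * x)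
  rw [mul_zero] at this
  refine this.congr fun n ↦ ?_
  rw [Nat.add_sub_cancel, pow_succ]
  ring

/-- A nonzero integer plus a Galois-equivariant combination of exponentials of nonzero algebraic
numbers does not vanish. -/
theorem int_add_sum_exp_ne_zero {K : Type*} [Field K] [NumberField K] [IsGalois ℚ K]
    (ι : K →+* ℂ) (s : Finset K) (hs : (0 : K) ∉ s) (h : K → K)
    (hmem : ∀ (σ : K ≃ₐ[ℚ] K), ∀ a ∈ s, σ a ∈ s)
    (hh : ∀ (σ : K ≃ₐ[ℚ] K) (a : K), h (σ a) = σ (h a)) {N : ℤ} (hN : N ≠ 0) :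
    (N : ℂ) + ∑ a ∈ s, ι (h a) * Complex.exp (ι a) ≠ 0 := by
  classical
  intro hsum
  obtain ⟨f, hf0, hf⟩ := exists_int_polynomial_eval_zero_ne_zero s hs
  obtain ⟨c, hc⟩ := exp_polynomial_approx f hf0
  have : Algebra.IsAlgebraic ℤ K :=
    (IsFractionRing.comap_isAlgebraic_iff (A := ℤ) (K := ℚ)).mpr inferInstance
  obtain ⟨l, hl0, hl⟩ := Algebra.IsAlgebraic.exists_integral_multiples ℤ (s ∪ s.image h)
  set D := f.natDegree
  set C : ℝ := ∑ a ∈ s, ‖ι (h a)‖ with hC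
  have hlim := tendsto_mul_pow_div_factorial_pred (|(l : ℝ)| * C) (|(l : ℝ)| ^ D * c)
  obtain ⟨n₀, hn₀⟩ := Filter.eventually_atTop.mp (hlim.eventually_lt_const one_pos)
  obtain ⟨p, hp, hprime⟩ :=
    Nat.exists_infinite_primes (n₀ + (f.eval 0).natAbs + N.natAbs + l.natAbs + 1)
  obtain ⟨n, hpn, g, hgdeg, hg⟩ := hc p (by omega) hprime
  have hι (a : K) (g : ℤ[X]) : ι (aeval a g) = aeval (ι a) g :=
    (aeval_algHom_apply ι.toIntAlgHom a g).symm
  have hroot : ∀ a ∈ s, ι a ∈ f.aroots ℂ := fun a ha ↦ by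
    rw [mem_aroots]
    refine ⟨fun h0 ↦ hf0 (by simp [h0]), ?_⟩
    have := congrArg ι (hf a ha)
    rwa [map_zero, hι] at this
  have hint : IsIntegral ℤ (l ^ (p * D + 1) • ∑ a ∈ s, h a * aeval a g) := by
    rw [Finset.smul_sum]
    refine IsIntegral.sum _ fun a ha ↦ ?_
    have h1 : IsIntegral ℤ (l ^ (p * D) • aeval a g) :=
      isIntegral_pow_mul_aeval (hl a (Finset.mem_union_left _ ha)) g (by omega)
    have h2 := hl (h a) (Finset.mem_union_right _ (Finset.mem_image_of_mem h ha))
    have : l ^ (p * D + 1) • (h a * aeval a g) = (l • h a) * (l ^ (p * D) • aeval a g) := by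
      rw [smul_mul_smul_comm, pow_succ']
    rw [this]
    exact h2.mul h1
  have hfix (σ : K ≃ₐ[ℚ] K) : σ (l ^ (p * D + 1) • ∑ a ∈ s, h a * aeval a g) =
      l ^ (p * D + 1) • ∑ a ∈ s, h a * aeval a g := by
    rw [map_zsmul, map_sum]
    congr 1
    have hinj : Set.InjOn σ s := σ.injective.injOn
    have himg : s.image σ = s := Finset.eq_of_subset_of_card_le
      (Finset.image_subset_iff.mpr (hmem σ)) (Finset.card_image_of_injOn hinj).ge
    conv_rhs => rw [← himg, Finset.sum_image hinj]
    refine Finset.sum_congr rfl fun a _ ↦ ?_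
    rw [map_mul, hh]
    congr 1
    exact (aeval_algHom_apply (σ.toAlgHom.restrictScalars ℤ) a g).symm
  obtain ⟨M, hM⟩ := exists_int_eq_of_isIntegral_of_forall_fixed hint hfix
  set Z : ℤ := l ^ (p * D + 1) * (n * N) + p * M with hZ
  have hp' : Prime (p : ℤ) := Nat.prime_iff_prime_int.mp hprime
  have hndvd {k : ℤ} (hk : k ≠ 0) (hkp : k.natAbs < p) : ¬ (p : ℤ) ∣ k := fun hd ↦
    (Nat.le_of_dvd (Int.natAbs_pos.mpr hk) (Int.natCast_dvd.mp hd)).not_gt hkp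
  have hZ0 : Z ≠ 0 := by
    intro h0
    have hd : (p : ℤ) ∣ l ^ (p * D + 1) * (n * N) :=
      (dvd_add_left (dvd_mul_right _ _)).mp (h0 ▸ dvd_zero _)
    rcases hp'.dvd_or_dvd hd with hd | hd
    · exact hndvd hl0 (by omega) (hp'.dvd_of_dvd_pow hd)
    · exact (hp'.dvd_or_dvd hd).elim hpn (hndvd hN (by omega))
  have hZC : (Z : ℂ) = -((l : ℂ) ^ (p * D + 1) *
      ∑ a ∈ s, ι (h a) * (n • Complex.exp (ι a) - p • aeval (ι a) g)) := by
    have hMC := congrArg ι hM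
    simp only [map_intCast, zsmul_eq_mul, Int.cast_pow, map_pow, map_sum, map_mul, hι] at hMC
    have h1 : ∑ a ∈ s, ι (h a) * (n • Complex.exp (ι a) - p • aeval (ι a) g) =
        n * ∑ a ∈ s, ι (h a) * Complex.exp (ι a) - p * ∑ a ∈ s, ι (h a) * aeval (ι a) g := by
      rw [Finset.mul_sum, Finset.mul_sum, ← Finset.sum_sub_distrib]
      refine Finset.sum_congr rfl fun a _ ↦ ?_
      rw [zsmul_eq_mul, nsmul_eq_mul]
      ring
    rw [h1, hZ]
    push_cast
    rw [hMC]
    linear_combination (l : ℂ) ^ (p * D + 1) * n * hsum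
  have hle : ‖(Z : ℂ)‖ ≤ |(l : ℝ)| * C * ((|(l : ℝ)| ^ D * c) ^ p / (p - 1)!) := by
    rw [hZC, norm_neg, norm_mul, norm_pow, Complex.norm_intCast]
    have : |(l : ℝ)| * C * ((|(l : ℝ)| ^ D * c) ^ p / (p - 1)!) =
        |(l : ℝ)| ^ (p * D + 1) * (C * (c ^ p / (p - 1)!)) := by
      rw [mul_pow, ← pow_mul, mul_comm D p]
      ring
    rw [this, hC, Finset.sum_mul]
    gcongr
    refine (norm_sum_le _ _).trans (Finset.sum_le_sum fun a ha ↦ ?_)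
    rw [norm_mul]
    gcongr
    exact hg (hroot a ha)
  have hlt := hle.trans_lt (hn₀ p (by omega))
  rw [Complex.norm_intCast, ← Int.cast_abs] at hlt
  exact (Int.one_le_abs hZ0).not_gt (by exact_mod_cast hlt)

section GroupAlgebra

open AddMonoidAlgebra

variable {K : Type*} [Field K]

/-- The evaluation `∑ bₐ [a] ↦ ∑ ι(bₐ) exp(ι(a))` on the group algebra of `(K, +)` over `K`. -/
noncomputable def expEval (ι : K →+* ℂ) : AddMonoidAlgebra K K →+* ℂ :=
  liftNCRingHom ι
    (Complex.expMonoidHom.comp (AddMonoidHom.toMultiplicative ι.toAddMonoidHom))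
    fun _ _ ↦ Commute.all _ _

theorem expEval_single (ι : K →+* ℂ) (a b : K) :
    expEval ι (single a b) = ι b * Complex.exp (ι a) :=
  liftNCRingHom_single _ _ _ _ _

theorem expEval_eq_sum (ι : K →+* ℂ) (x : AddMonoidAlgebra K K) :
    expEval ι x = ∑ a ∈ x.coeff.support, ι (x.coeff a) * Complex.exp (ι a) := by
  conv_lhs => rw [← sum_coeff_single x, map_finsuppSum]
  simp only [expEval_single, Finsupp.sum]

variable [CharZero K]

/-- The diagonal Galois action `∑ bₐ [a] ↦ ∑ σ(bₐ) [σ(a)]` on the group algebra. -/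
noncomputable def galMap (σ : K ≃ₐ[ℚ] K) : AddMonoidAlgebra K K →+* AddMonoidAlgebra K K :=
  (mapDomainRingHom K (σ : K →+ K)).comp (mapRingHom K (σ : K →+* K))

theorem galMap_single (σ : K ≃ₐ[ℚ] K) (a b : K) :
    galMap σ (single a b) = single (σ a) (σ b) := by
  simp [galMap]

theorem galMap_galMap (σ τ : K ≃ₐ[ℚ] K) (x : AddMonoidAlgebra K K) :
    galMap σ (galMap τ x) = galMap (σ * τ) x := by
  have : (galMap σ).comp (galMap τ) = galMap (σ * τ) := by
    ext <;> simp [galMap_single]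
  exact DFunLike.congr_fun this x

theorem galMap_one (x : AddMonoidAlgebra K K) : galMap 1 x = x := by
  have : galMap (1 : K ≃ₐ[ℚ] K) = RingHom.id _ := by
    ext <;> simp [galMap_single]
  exact DFunLike.congr_fun this x

theorem coeff_galMap (σ : K ≃ₐ[ℚ] K) (x : AddMonoidAlgebra K K) (a : K) :
    (galMap σ x).coeff (σ a) = σ (x.coeff a) := by
  have : (galMap σ x).coeff (σ a) = (mapRingHom K (σ : K →+* K) x).coeff a :=
    Finsupp.mapDomain_apply σ.injective _ _
  simp [this]

theorem galMap_injective (σ : K ≃ₐ[ℚ] K) : Function.Injective (galMap σ) := fun x y hxy ↦ by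
  rw [← galMap_one x, ← galMap_one y, ← inv_mul_cancel σ, ← galMap_galMap, hxy, galMap_galMap]

end GroupAlgebra

theorem expEval_ne_zero_of_galMap_eq {K : Type*} [Field K] [NumberField K] [IsGalois ℚ K]
    (ι : K →+* ℂ) {x : AddMonoidAlgebra K K} (hx : ∀ σ : K ≃ₐ[ℚ] K, galMap σ x = x)
    {N : ℤ} (hN : N ≠ 0) (hxN : x.coeff 0 = N) : expEval ι x ≠ 0 := by
  have hcoeff (σ : K ≃ₐ[ℚ] K) (a : K) : x.coeff (σ a) = σ (x.coeff a) := by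
    conv_lhs => rw [← hx σ]
    exact coeff_galMap σ x a
  classical
  have h0 : (0 : K) ∈ x.coeff.support := by simpa [hxN] using hN
  have := int_add_sum_exp_ne_zero ι (x.coeff.support.erase 0) (Finset.notMem_erase _ _) x.coeff
    (fun σ a ha ↦ by simpa [hcoeff] using ha) hcoeff hN
  rw [expEval_eq_sum, ← Finset.add_sum_erase _ _ h0, hxN]
  simpa using this

/-- The Lindemann-Weierstrass theorem: exponentials of distinct elements of a number field are
linearly independent over that field. -/
theorem expEval_injective {K : Type*} [Field K] [NumberField K] [IsGalois ℚ K]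
    (ι : K →+* ℂ) :
    Function.Injective (expEval ι) := by
  rw [injective_iff_map_eq_zero]
  by_contra! ⟨x, hx, hx0⟩
  set y := ∏ σ : K ≃ₐ[ℚ] K, galMap σ x with hy
  have hy0 : y ≠ 0 := Finset.prod_ne_zero_iff.mpr fun σ _ ↦
    (map_ne_zero_iff _ (galMap_injective σ)).mpr hx0
  have hyι : expEval ι y = 0 := by
    rw [hy, map_prod]
    exact Finset.prod_eq_zero (Finset.mem_univ 1) (by rw [galMap_one, hx])
  have hyσ (σ : K ≃ₐ[ℚ] K) : galMap σ y = y := by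
    simp only [hy, map_prod, galMap_galMap]
    exact Fintype.prod_equiv (Equiv.mulLeft σ) _ _ fun _ ↦ rfl
  obtain ⟨a, ha⟩ : ∃ a, y.coeff a ≠ 0 := by
    by_contra! h
    exact hy0 (by ext a; simpa using h a)
  set t : AddMonoidAlgebra K K := .single (-a) (y.coeff a)⁻¹
  have ht : (y * t).coeff 0 = 1 := by
    rw [AddMonoidAlgebra.coeff_mul_single_eq_coeff_mul a fun b _ ↦ by rw [add_neg_eq_zero],
      mul_inv_cancel₀ ha]
  refine expEval_ne_zero_of_galMap_eq ι (x := ∑ σ : K ≃ₐ[ℚ] K, galMap σ (y * t))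
    (N := Fintype.card (K ≃ₐ[ℚ] K)) (fun σ ↦ ?_) (by exact_mod_cast Fintype.card_ne_zero) ?_ ?_
  · simp only [map_sum, galMap_galMap]
    exact Fintype.sum_equiv (Equiv.mulLeft σ) _ _ fun _ ↦ rfl
  · have h1 (σ : K ≃ₐ[ℚ] K) : (galMap σ (y * t)).coeff 0 = 1 := by
      rw [← map_zero σ, coeff_galMap, ht, map_one]
    simp only [AddMonoidAlgebra.coeff_sum, Finsupp.finsetSum_apply, h1]
    simp
  · simp only [map_mul, hyσ, ← Finset.mul_sum, hyι, zero_mul]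

theorem exists_isGalois_intermediateField (s : Finset ℂ) (hs : ∀ a ∈ s, IsAlgebraic ℚ a) :
    ∃ K : IntermediateField ℚ ℂ, NumberField K ∧ IsGalois ℚ K ∧ ∀ a ∈ s, a ∈ K := by
  set q : ℚ[X] := ∏ a ∈ s, minpoly ℚ a with hq
  have hq0 : q ≠ 0 := Finset.prod_ne_zero_iff.mpr fun a ha ↦ minpoly.ne_zero (hs a ha).isIntegral
  have hsplit : IsSplittingField ℚ (IntermediateField.adjoin ℚ (q.rootSet ℂ)) q :=
    IntermediateField.adjoin_rootSet_isSplittingField (IsAlgClosed.splits _)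
  have hfin := IsSplittingField.finiteDimensional (IntermediateField.adjoin ℚ (q.rootSet ℂ)) q
  have hnormal := Normal.of_isSplittingField (E := IntermediateField.adjoin ℚ (q.rootSet ℂ)) q
  refine ⟨IntermediateField.adjoin ℚ (q.rootSet ℂ), ⟨⟩, ⟨⟩, fun a ha ↦ ?_⟩
  refine IntermediateField.subset_adjoin ℚ _ ((mem_rootSet_of_ne hq0).mpr ?_)
  rw [hq, map_prod]
  exact Finset.prod_eq_zero ha (minpoly.aeval ℚ a)

end LindemannWeierstrass

open LindemannWeierstrass

/-- If `α 1, …, α m` are pairwise distinct nonzero algebraic complex numbers and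
`c 1, …, c m` are rational numbers not all zero, then `∑ cᵢ e^{αᵢ}` is transcendental. -/
theorem lindemann_weierstrass_number_transcendental (m : ℕ) (α : Fin m → ℂ)
    (hdist : Function.Injective α) (hne : ∀ i, α i ≠ 0)
    (halg : ∀ i, IsAlgebraic ℚ (α i))
    (c : Fin m → ℚ) (hc : ∃ i, c i ≠ 0) :
    Transcendental ℚ (∑ i, (c i : ℂ) * Complex.exp (α i)) := by
  classical
  intro hβ
  obtain ⟨K, _, _, hK⟩ := exists_isGalois_intermediateField
    (insert (∑ i, (c i : ℂ) * Complex.exp (α i)) (Finset.univ.image α))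
    (by simpa [hβ] using halg)
  obtain ⟨j, hj⟩ := hc
  have hα (i : Fin m) : α i ∈ K := hK _ (by simp)
  set β : K := ⟨∑ i, (c i : ℂ) * Complex.exp (α i), hK _ (by simp)⟩
  set a : Fin m → K := fun i ↦ ⟨α i, hα i⟩
  have ha : Function.Injective a := fun i k hik ↦ hdist (congrArg Subtype.val hik)
  set x : AddMonoidAlgebra K K :=
    ∑ i, AddMonoidAlgebra.single (a i) (c i : K) - AddMonoidAlgebra.single 0 β with hx
  have hx0 : x = 0 := by
    apply expEval_injective (algebraMap K ℂ)
    rw [hx, map_sub, map_sum, map_zero]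
    simp only [expEval_single, map_zero, Complex.exp_zero, mul_one, map_ratCast]
    exact sub_self _
  have hxj : x.coeff (a j) = c j := by
    have ha0 : a j ≠ 0 := fun h ↦ hne j (congrArg Subtype.val h)
    simp [hx, Finsupp.single_apply, ha.eq_iff, ha0.symm]
  rw [hx0] at hxj
  exact hj (by simpa using hxj.symm)
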